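/- arXiv:0711.0838 — 2 statements merged into one kernel-verified Lean document; each statement's English description precedes it below -/
import Mathlib

section
/- Let M be a set, B a set, and 𝒮 a set of functions from M to B satisfying: (1) if S1, S2 ∈ 𝒮, M' ⊆ M, and S3 : M → B satisfies S3(x) = S1(x) for x ∈ M' and S3(x) = S2(x) for x ∉ M', then S3 ∈ 𝒮; and (2) for all S1, S2 ∈ 𝒮 the set {x ∈ M | S1(x) ≠ S2(x)} is finite. Let O : 𝒮 → 𝒮, and let oreg(O) = {x ∈ M | ∃S ∈ 𝒮, S(x) ≠ O(S)(x)} and ireg(O) = {x ∈ M | ∃S1, S2 ∈ 𝒮 with S1(z) = S2(z) for all z ∈ M ∖ {x}, ∃y ∈ oreg(O), O(S1)(y) ≠ O(S2)(y)}. Then for all S1, S2 ∈ 𝒮: if S1 and S2 agree on ireg(O), then O(S1) and O(S2) agree on oreg(O). -/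
/-- **Fundamental property of input and output regions (Maurer).**
Let `𝒮` be a set of functions `M → B` (states) such that (1) pasting two
states along any set `M' ⊆ M` again yields a state, and (2) any two states
differ in only finitely many memory elements.  Let `O` map states to states,
let `oreg` be its output region and `ireg` its input region.  Then any two
states that agree on the input region are transformed by `O` to states that
agree on the output region. -/
theorem ireg_oreg_agree {M B : Type*} (𝒮 : Set (M → B))
    (h1 : ∀ S₁ ∈ 𝒮, ∀ S₂ ∈ 𝒮, ∀ M' : Set M, ∀ S₃ : M → B,
      (∀ x ∈ M', S₃ x = S₁ x) → (∀ x ∉ M', S₃ x = S₂ x) → S₃ ∈ 𝒮)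
    (h2 : ∀ S₁ ∈ 𝒮, ∀ S₂ ∈ 𝒮, {x | S₁ x ≠ S₂ x}.Finite)
    (O : (M → B) → (M → B)) (hO : ∀ S ∈ 𝒮, O S ∈ 𝒮)
    (oreg ireg : Set M)
    (horeg : oreg = {x | ∃ S ∈ 𝒮, S x ≠ O S x})
    (hireg : ireg = {x | ∃ S₁ ∈ 𝒮, ∃ S₂ ∈ 𝒮,
      (∀ z, z ≠ x → S₁ z = S₂ z) ∧ ∃ y ∈ oreg, O S₁ y ≠ O S₂ y})
    (S₁ : M → B) (hS₁ : S₁ ∈ 𝒮) (S₂ : M → B) (hS₂ : S₂ ∈ 𝒮)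
    (hagree : ∀ x ∈ ireg, S₁ x = S₂ x) :
    ∀ y ∈ oreg, O S₁ y = O S₂ y := by
  classical
  intro y hy
  suffices key : ∀ F : Finset M, ∀ S ∈ 𝒮, (∀ x ∉ F, S x = S₂ x) →
      (∀ x ∈ ireg, S x = S₂ x) → O S y = O S₂ y from
    key (h2 S₁ hS₁ S₂ hS₂).toFinset S₁ hS₁ (fun x hx => by simpa using hx) hagree
  intro F
  induction F using Finset.induction_on with
  | empty =>
    intro S _ hoff _
    rw [funext fun x => hoff x (Finset.notMem_empty x)]
  | insert a F _ ih =>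
    intro S hS hoff hon
    have hmem : Function.update S a (S₂ a) ∈ 𝒮 :=
      h1 S₂ hS₂ S hS {a} _ (fun x hx => by simp [Set.mem_singleton_iff.mp hx])
        (fun x hx => Function.update_of_ne (by simpa using hx) _ _)
    have hupdate : O (Function.update S a (S₂ a)) y = O S₂ y := by
      refine ih _ hmem (fun x hx => ?_) (fun x hx => ?_) <;>
        rcases eq_or_ne x a with rfl | hxa
      · simp
      · simpa [hxa] using hoff x (by simp [hxa, hx])
      · simp
      · simpa [hxa] using hon x hx
    by_cases hstep : O S y = O (Function.update S a (S₂ a)) y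
    · exact hstep.trans hupdate
    · have ha : a ∈ ireg := by
        rw [hireg]
        exact ⟨S, hS, _, hmem, fun z hz => (Function.update_of_ne hz _ _).symm, y, hy, hstep⟩
      rwa [← hon a ha, Function.update_eq_self] at hupdate
end

section
/- Let aw, wl > 1 with 2·aw − 4 ≤ wl, and let iss, ssb > 0 satisfy iss ≤ 2^wl − 4 and ssb ≤ 2^(aw−2). Then ((iss + 4) · ssb²)^ssb ≤ 2^(2^(aw−1) · wl). -/
/-- For `aw, wl > 1` with `2·aw - 4 ≤ wl`, `iss ≤ 2^wl - 4` and
`ssb ≤ 2^(aw-2)` (with `iss, ssb > 0`), the number `((iss + 4) · ssb²)^ssb`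
of threads with at most `ssb` residual states over `iss` data manipulation
instructions plus one load and one store instruction is at most `2^ems`,
where `ems = 2^(aw-1) · wl` is the external memory size in bits. -/
theorem thread_count_le_two_pow_ems (aw wl iss ssb : ℕ)
    (haw : 1 < aw) (hwl : 1 < wl) (hawwl : 2 * aw - 4 ≤ wl)
    (hiss : 0 < iss) (hssb : 0 < ssb)
    (hiss' : iss ≤ 2 ^ wl - 4) (hssb' : ssb ≤ 2 ^ (aw - 2)) :
    ((iss + 4) * ssb ^ 2) ^ ssb ≤ 2 ^ (2 ^ (aw - 1) * wl) := by
  obtain ⟨k, rfl⟩ : ∃ k, aw = k + 2 := ⟨aw - 2, by omega⟩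
  simp only [Nat.add_sub_cancel] at hssb'
  have hinstr : iss + 4 ≤ 2 ^ wl := by omega
  have hstates : ssb ^ 2 ≤ 2 ^ wl :=
    calc ssb ^ 2 ≤ (2 ^ k) ^ 2 := Nat.pow_le_pow_left hssb' 2
      _ = 2 ^ (k * 2) := (pow_mul 2 k 2).symm
      _ ≤ 2 ^ wl := Nat.pow_le_pow_right two_pos (by omega)
  calc ((iss + 4) * ssb ^ 2) ^ ssb
      ≤ (2 ^ wl * 2 ^ wl) ^ ssb := Nat.pow_le_pow_left (Nat.mul_le_mul hinstr hstates) ssb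
    _ = 2 ^ ((wl + wl) * ssb) := by rw [← pow_add, ← pow_mul]
    _ ≤ 2 ^ ((wl + wl) * 2 ^ k) :=
      Nat.pow_le_pow_right two_pos (Nat.mul_le_mul_left _ hssb')
    _ = 2 ^ (2 ^ (k + 2 - 1) * wl) := by
      rw [show k + 2 - 1 = k + 1 by omega]
      ring_nf
end
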